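/- Inverse function theorem in a cone: let K = {r·e^{iτ} : 0 < r < r₀, τ₁ < τ < τ₂} with 0 < τ₂ − τ₁ < 2π, and let ŵ : K → ℂ be holomorphic with ŵ(z) → 0 and ŵ'(z) → c ≠ 0 as z → 0 in K. Then there is a neighborhood U of 0 such that ŵ is injective on K ∩ U, its inverse ẑ : ŵ(K ∩ U) → K ∩ U is analytic, and ẑ(w) → 0, ẑ'(w) → 1/c as w → 0 in ŵ(K ∩ U). -/

import Mathlib

open Set Filter Topology

/-- The open circular sector of radius `r₀` at the origin with arguments in `(τ₁, τ₂)`. -/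
def circularSector (r₀ τ₁ τ₂ : ℝ) : Set ℂ :=
  {z : ℂ | ∃ r τ : ℝ, 0 < r ∧ r < r₀ ∧ τ₁ < τ ∧ τ < τ₂ ∧
    z = (r : ℂ) * Complex.exp (τ * Complex.I)}

theorem norm_ofReal_mul_exp_mul_I {r : ℝ} (hr : 0 < r) (τ : ℝ) :
    ‖(r : ℂ) * Complex.exp (τ * Complex.I)‖ = r := by
  rw [norm_mul, Complex.norm_exp_ofReal_mul_I, mul_one, Complex.norm_real, Real.norm_of_nonneg hr.le]

theorem isOpen_circularSector (r₀ τ₁ τ₂ : ℝ) : IsOpen (circularSector r₀ τ₁ τ₂) := by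
  have h : circularSector r₀ τ₁ τ₂ =
      Complex.exp '' {s : ℂ | Real.exp s.re < r₀ ∧ τ₁ < s.im ∧ s.im < τ₂} := by
    ext z
    constructor
    · rintro ⟨r, τ, h0, h1, h2, h3, rfl⟩
      refine ⟨(Real.log r : ℂ) + τ * Complex.I, by simp [Real.exp_log h0, *], ?_⟩
      rw [Complex.exp_add, ← Complex.ofReal_exp, Real.exp_log h0]
    · rintro ⟨s, ⟨h1, h2, h3⟩, rfl⟩
      refine ⟨Real.exp s.re, s.im, Real.exp_pos _, h1, h2, h3, ?_⟩
      rw [Complex.ofReal_exp, ← Complex.exp_add, Complex.re_add_im]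
  rw [h]
  refine Complex.isOpenMap_exp _ ?_
  exact (isOpen_lt (Real.continuous_exp.comp Complex.continuous_re) continuous_const).inter
    ((isOpen_lt continuous_const Complex.continuous_im).inter
      (isOpen_lt Complex.continuous_im continuous_const))

theorem circularSector_inter_ball {r₀ δ : ℝ} (τ₁ τ₂ : ℝ) (h : δ ≤ r₀) :
    circularSector r₀ τ₁ τ₂ ∩ Metric.ball 0 δ = circularSector δ τ₁ τ₂ := by
  ext z
  constructor
  · rintro ⟨⟨r, τ, h0, h1, h2, h3, rfl⟩, hz⟩
    rw [mem_ball_zero_iff, norm_ofReal_mul_exp_mul_I h0] at hz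
    exact ⟨r, τ, h0, hz, h2, h3, rfl⟩
  · rintro ⟨r, τ, h0, h1, h2, h3, rfl⟩
    refine ⟨⟨r, τ, h0, h1.trans_le h, h2, h3, rfl⟩, ?_⟩
    rwa [mem_ball_zero_iff, norm_ofReal_mul_exp_mul_I h0]

theorem zero_mem_closure_circularSector {δ τ₁ τ₂ : ℝ} (hδ : 0 < δ) (hτ : τ₁ < τ₂) :
    (0 : ℂ) ∈ closure (circularSector δ τ₁ τ₂) := by
  rw [Metric.mem_closure_iff]
  intro ε hε
  obtain ⟨τ, h1, h2⟩ := exists_between hτ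
  obtain ⟨r, h3, h4⟩ := exists_between (lt_min hδ hε)
  refine ⟨_, ⟨r, τ, h3, h4.trans_le (min_le_left _ _), h1, h2, rfl⟩, ?_⟩
  rw [dist_zero_left, norm_ofReal_mul_exp_mul_I h3]
  exact h4.trans_le (min_le_right _ _)

theorem exists_mul_abs_le_norm_exp_I_sub_one {a : ℝ} (ha : 0 < a) (ha' : a < 2 * Real.pi) :
    ∃ m : ℝ, 0 < m ∧ ∀ x : ℝ, |x| ≤ a → m * |x| ≤ ‖Complex.exp (Complex.I * x) - 1‖ := by
  have hs : 0 < Real.sin (a / 2) := Real.sin_pos_of_pos_of_lt_pi (by linarith) (by linarith)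
  refine ⟨2 * Real.sin (a / 2) / a, by positivity, fun x hx => ?_⟩
  have ht : |x| / a ∈ Icc (0 : ℝ) 1 := ⟨by positivity, (div_le_one ha).2 hx⟩
  have hmem : a / 2 ∈ Icc 0 Real.pi := ⟨by linarith, by linarith⟩
  have hmem0 : (0 : ℝ) ∈ Icc 0 Real.pi := ⟨le_rfl, Real.pi_pos.le⟩
  have hc := strictConcaveOn_sin_Icc.concaveOn.2 hmem hmem0 ht.1 (sub_nonneg.2 ht.2)
    (add_sub_cancel _ _)
  simp only [smul_eq_mul, Real.sin_zero, mul_zero, add_zero] at hc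
  rw [show |x| / a * (a / 2) = |x| / 2 by field_simp] at hc
  have habs : |Real.sin (x / 2)| = |Real.sin (|x| / 2)| := by
    rcases abs_cases x with ⟨h, _⟩ | ⟨h, _⟩ <;> rw [h]
    rw [neg_div, Real.sin_neg, abs_neg]
  rw [Complex.norm_exp_I_mul_ofReal_sub_one, Real.norm_eq_abs, abs_mul, abs_two, habs]
  calc 2 * Real.sin (a / 2) / a * |x| = 2 * (|x| / a * Real.sin (a / 2)) := by ring
    _ ≤ 2 * |Real.sin (|x| / 2)| := by gcongr; exact hc.trans (le_abs_self _)

/-- In polar coordinates with arguments in an interval of length less than `2π`, the length of the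
path made of an arc and a radial segment is controlled by the distance of the endpoints. -/
theorem exists_polar_path_length_le {τ₁ τ₂ : ℝ} (hτ : 0 < τ₂ - τ₁) (hτ' : τ₂ - τ₁ < 2 * Real.pi) :
    ∃ M : ℝ, 0 < M ∧ ∀ r s α β : ℝ, 0 < r → 0 < s → α ∈ Ioo τ₁ τ₂ → β ∈ Ioo τ₁ τ₂ →
      r * |β - α| + |s - r| ≤
        M * ‖(s : ℂ) * Complex.exp (β * Complex.I) - r * Complex.exp (α * Complex.I)‖ := by
  obtain ⟨m, hm, hchord⟩ := exists_mul_abs_le_norm_exp_I_sub_one hτ hτ'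
  refine ⟨2 / m + 1, by positivity, fun r s α β hr hs hα hβ => ?_⟩
  set D := ‖(s : ℂ) * Complex.exp (β * Complex.I) - r * Complex.exp (α * Complex.I)‖ with hD
  have hrad : |s - r| ≤ D := by
    have := abs_norm_sub_norm_le ((s : ℂ) * Complex.exp (β * Complex.I))
      (r * Complex.exp (α * Complex.I))
    rwa [norm_ofReal_mul_exp_mul_I hr, norm_ofReal_mul_exp_mul_I hs] at this
  have hr' : ‖(r : ℂ) * Complex.exp (β * Complex.I) - s * Complex.exp (β * Complex.I)‖
      = |s - r| := by
    rw [← sub_mul, norm_mul, Complex.norm_exp_ofReal_mul_I, mul_one, ← Complex.ofReal_sub,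
      Complex.norm_real, Real.norm_eq_abs, abs_sub_comm]
  have harc : ‖(r : ℂ) * Complex.exp (β * Complex.I) - r * Complex.exp (α * Complex.I)‖
      = r * ‖Complex.exp (Complex.I * ((β - α : ℝ) : ℂ)) - 1‖ := by
    have : (r : ℂ) * Complex.exp (β * Complex.I) - r * Complex.exp (α * Complex.I)
        = r * Complex.exp (α * Complex.I) *
          (Complex.exp (Complex.I * ((β - α : ℝ) : ℂ)) - 1) := by
      rw [mul_sub, mul_assoc, ← Complex.exp_add, mul_one]
      congr 3
      push_cast
      ring
    rw [this, norm_mul, norm_ofReal_mul_exp_mul_I hr]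
  have htri := norm_sub_le_norm_sub_add_norm_sub ((r : ℂ) * Complex.exp (β * Complex.I))
    (s * Complex.exp (β * Complex.I)) (r * Complex.exp (α * Complex.I))
  rw [hr', harc, ← hD] at htri
  have hc := hchord (β - α) (abs_le.2 ⟨by linarith [hα.2, hβ.1], by linarith [hα.1, hβ.2]⟩)
  have hmul : m * (r * |β - α|) ≤ 2 * D := by
    calc m * (r * |β - α|) = r * (m * |β - α|) := by ring
      _ ≤ r * ‖Complex.exp (Complex.I * ((β - α : ℝ) : ℂ)) - 1‖ := by gcongr
      _ ≤ 2 * D := by linarith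
  have : r * |β - α| ≤ 2 / m * D := by
    rw [div_mul_eq_mul_div, le_div_iff₀ hm]
    linarith
  linarith

/-- A mean value inequality on circular sectors of opening angle less than `2π`, with a constant
depending only on the opening angle. -/
theorem exists_norm_sub_le_of_norm_hasDerivAt_le_circularSector {τ₁ τ₂ : ℝ} (hτ : 0 < τ₂ - τ₁)
    (hτ' : τ₂ - τ₁ < 2 * Real.pi) :
    ∃ M : ℝ, 0 < M ∧ ∀ (δ ε : ℝ) (f f' : ℂ → ℂ), 0 ≤ ε →
      (∀ x ∈ circularSector δ τ₁ τ₂, HasDerivAt f (f' x) x) →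
      (∀ x ∈ circularSector δ τ₁ τ₂, ‖f' x‖ ≤ ε) →
      ∀ x ∈ circularSector δ τ₁ τ₂, ∀ y ∈ circularSector δ τ₁ τ₂,
        ‖f y - f x‖ ≤ M * ε * ‖y - x‖ := by
  obtain ⟨M, hM, hpath⟩ := exists_polar_path_length_le hτ hτ'
  refine ⟨M, hM, fun δ ε f f' hε hf hb => ?_⟩
  rintro _ ⟨r, α, hr0, hr1, hα1, hα2, rfl⟩ _ ⟨s, β, hs0, hs1, hβ1, hβ2, rfl⟩
  have hrad : ‖f (s * Complex.exp (β * Complex.I)) - f (r * Complex.exp (β * Complex.I))‖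
      ≤ ε * |s - r| := by
    refine (convex_Ioo (0 : ℝ) δ).norm_image_sub_le_of_norm_hasDerivWithin_le
      (f := fun t : ℝ => f (t * Complex.exp (β * Complex.I)))
      (f' := fun t : ℝ => f' (t * Complex.exp (β * Complex.I)) * Complex.exp (β * Complex.I))
      (fun t ht => ?_) (fun t ht => ?_) ⟨hr0, hr1⟩ ⟨hs0, hs1⟩
    · have h1 : HasDerivAt (fun z : ℂ => z * Complex.exp (β * Complex.I))
          (Complex.exp (β * Complex.I)) (t : ℂ) := by
        simpa using (hasDerivAt_id (t : ℂ)).mul_const (Complex.exp (β * Complex.I))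
      exact ((hf _ ⟨t, β, ht.1, ht.2, hβ1, hβ2, rfl⟩).comp (t : ℂ) h1).comp_ofReal.hasDerivWithinAt
    · rw [norm_mul, Complex.norm_exp_ofReal_mul_I, mul_one]
      exact hb _ ⟨t, β, ht.1, ht.2, hβ1, hβ2, rfl⟩
  have harc : ‖f (r * Complex.exp (β * Complex.I)) - f (r * Complex.exp (α * Complex.I))‖
      ≤ ε * r * |β - α| := by
    refine (convex_Ioo τ₁ τ₂).norm_image_sub_le_of_norm_hasDerivWithin_le
      (f := fun t : ℝ => f (r * Complex.exp (t * Complex.I)))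
      (f' := fun t : ℝ => f' (r * Complex.exp (t * Complex.I)) *
        (r * (Complex.exp (t * Complex.I) * Complex.I)))
      (fun t ht => ?_) (fun t ht => ?_) ⟨hα1, hα2⟩ ⟨hβ1, hβ2⟩
    · have h1 : HasDerivAt (fun z : ℂ => r * Complex.exp (z * Complex.I))
          (r * (Complex.exp (t * Complex.I) * Complex.I)) (t : ℂ) := by
        simpa using (((hasDerivAt_id (t : ℂ)).mul_const Complex.I).cexp).const_mul (r : ℂ)
      exact ((hf _ ⟨r, t, hr0, hr1, ht.1, ht.2, rfl⟩).comp (t : ℂ) h1).comp_ofReal.hasDerivWithinAt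
    · rw [← mul_assoc (r : ℂ), norm_mul, norm_mul _ Complex.I, norm_ofReal_mul_exp_mul_I hr0,
        Complex.norm_I, mul_one]
      gcongr
      exact hb _ ⟨r, t, hr0, hr1, ht.1, ht.2, rfl⟩
  calc _ ≤ ε * |s - r| + ε * r * |β - α| :=
        (norm_sub_le_norm_sub_add_norm_sub _ _ _).trans (add_le_add hrad harc)
    _ = ε * (r * |β - α| + |s - r|) := by ring
    _ ≤ ε * (M * ‖(s : ℂ) * Complex.exp (β * Complex.I) - r * Complex.exp (α * Complex.I)‖) := by
        gcongr
        exact hpath r s α β hr0 hs0 ⟨hα1, hα2⟩ ⟨hβ1, hβ2⟩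
    _ = _ := by ring

/-- A left inverse on an open set of an expanding holomorphic function with nonvanishing derivative
is differentiable on the image. -/
theorem hasDerivAt_leftInvOn_of_mul_norm_sub_le {w z : ℂ → ℂ} {V : Set ℂ} (hV : IsOpen V)
    (hw : DifferentiableOn ℂ w V) {k : ℝ} (hk : 0 < k)
    (hexp : ∀ x ∈ V, ∀ y ∈ V, k * ‖y - x‖ ≤ ‖w y - w x‖) (hd : ∀ x ∈ V, deriv w x ≠ 0)
    (hz : LeftInvOn z w V) {x : ℂ} (hx : x ∈ V) :
    w '' V ∈ 𝓝 (w x) ∧ HasDerivAt z (deriv w x)⁻¹ (w x) := by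
  have hstrict : HasStrictDerivAt w (deriv w x) x :=
    (hw.analyticAt (hV.mem_nhds hx)).hasStrictDerivAt
  have himg : w '' V ∈ 𝓝 (w x) := by
    rw [← hstrict.map_nhds_eq (hd x hx)]
    exact image_mem_map (hV.mem_nhds hx)
  have hcont : ContinuousAt z (w x) := by
    rw [Metric.continuousAt_iff']
    intro ε hε
    filter_upwards [himg, Metric.ball_mem_nhds (w x) (mul_pos hk hε)]
    rintro _ ⟨y, hy, rfl⟩ hyx
    rw [Metric.mem_ball, dist_eq_norm] at hyx
    rw [hz hy, hz hx, dist_eq_norm]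
    exact lt_of_mul_lt_mul_left ((hexp x hx y hy).trans_lt hyx) hk.le
  refine ⟨himg, HasDerivAt.of_local_left_inverse (f := w) hcont ?_ (hd x hx) ?_⟩
  · rw [hz hx]
    exact hstrict.hasDerivAt
  · filter_upwards [himg]
    rintro _ ⟨y, hy, rfl⟩
    rw [hz hy]


/-- inverse function theorem in a cone. -/
theorem stmt14 (r₀ τ₁ τ₂ : ℝ) (hr₀ : 0 < r₀) (hτ : 0 < τ₂ - τ₁)
    (hτ' : τ₂ - τ₁ < 2 * Real.pi)
    (K : Set ℂ)
    (hK : K = {z : ℂ | ∃ r τ : ℝ, 0 < r ∧ r < r₀ ∧ τ₁ < τ ∧ τ < τ₂ ∧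
      z = (r : ℂ) * Complex.exp (τ * Complex.I)})
    (w : ℂ → ℂ) (hw : DifferentiableOn ℂ w K) (c : ℂ) (hc : c ≠ 0)
    (hw0 : Filter.Tendsto w (nhdsWithin 0 K) (nhds 0))
    (hw' : Filter.Tendsto (deriv w) (nhdsWithin 0 K) (nhds c)) :
    ∃ U ∈ nhds (0 : ℂ), Set.InjOn w (K ∩ U) ∧
      ∃ z : ℂ → ℂ, AnalyticOnNhd ℂ z (w '' (K ∩ U)) ∧
        Set.MapsTo z (w '' (K ∩ U)) (K ∩ U) ∧
        (∀ x ∈ K ∩ U, z (w x) = x) ∧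
        Filter.Tendsto z (nhdsWithin 0 (w '' (K ∩ U))) (nhds 0) ∧
        Filter.Tendsto (deriv z) (nhdsWithin 0 (w '' (K ∩ U))) (nhds c⁻¹) := by
  obtain ⟨M, hM, hmvt⟩ := exists_norm_sub_le_of_norm_hasDerivAt_le_circularSector hτ hτ'
  change K = circularSector r₀ τ₁ τ₂ at hK
  have hKo : IsOpen K := hK ▸ isOpen_circularSector r₀ τ₁ τ₂
  have hc' : 0 < ‖c‖ := norm_pos_iff.2 hc
  set ε : ℝ := min (‖c‖ / 2) (‖c‖ / (2 * M))
  have hε0 : 0 < ε := lt_min (by positivity) (by positivity)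
  obtain ⟨ρ, hρ, hρd⟩ := Metric.mem_nhdsWithin_iff.1 (hw' (Metric.closedBall_mem_nhds c hε0))
  set δ : ℝ := min ρ r₀
  have hδ : 0 < δ := lt_min hρ hr₀
  have hKδ : K ∩ Metric.ball 0 δ = circularSector δ τ₁ τ₂ := by
    rw [hK, circularSector_inter_ball _ _ (min_le_right _ _)]
  refine ⟨Metric.ball 0 δ, Metric.ball_mem_nhds _ hδ, ?_⟩
  set V := K ∩ Metric.ball 0 δ
  have hVK : V ⊆ K := inter_subset_left
  have hV : IsOpen V := hKo.inter Metric.isOpen_ball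
  have hwV : DifferentiableOn ℂ w V := hw.mono hVK
  have hb : ∀ x ∈ V, ‖deriv w x - c‖ ≤ ε := fun x hx => by
    rw [← dist_eq_norm]
    exact hρd ⟨Metric.ball_subset_ball (min_le_left _ _) hx.2, hx.1⟩
  have hd : ∀ x ∈ V, deriv w x ≠ 0 := fun x hx h => by
    have h1 := hb x hx
    rw [h, zero_sub, norm_neg] at h1
    linarith [min_le_left (‖c‖ / 2) (‖c‖ / (2 * M))]
  have hMε : M * ε ≤ ‖c‖ / 2 := by
    calc M * ε ≤ M * (‖c‖ / (2 * M)) := by gcongr; exact min_le_right _ _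
      _ = ‖c‖ / 2 := by field_simp
  have hexp : ∀ x ∈ V, ∀ y ∈ V, ‖c‖ / 2 * ‖y - x‖ ≤ ‖w y - w x‖ := fun x hx y hy => by
    have h1 := hmvt δ ε (fun x => w x - c * x) (fun x => deriv w x - c) hε0.le
      (fun x hx => by
        rw [← hKδ] at hx
        have h := (hasDerivAt_id x).const_mul c
        rw [mul_one] at h
        exact (hwV.differentiableAt (hV.mem_nhds hx)).hasDerivAt.sub h)
      (fun x hx => hb x (hKδ ▸ hx)) x (hKδ ▸ hx) y (hKδ ▸ hy)
    have h2 : ‖c * (y - x)‖ ≤ ‖w y - w x‖ + ‖w y - c * y - (w x - c * x)‖ := by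
      rw [show c * (y - x) = (w y - w x) - (w y - c * y - (w x - c * x)) by ring]
      exact norm_sub_le _ _
    rw [norm_mul] at h2
    have h3 : M * ε * ‖y - x‖ ≤ ‖c‖ / 2 * ‖y - x‖ := by gcongr
    linarith
  have hinj : InjOn w V := fun x hx y hy hxy => by
    have h1 := hexp x hx y hy
    rw [hxy, sub_self, norm_zero] at h1
    have h2 : ‖y - x‖ ≤ 0 := nonpos_of_mul_nonpos_right h1 (by positivity)
    exact (sub_eq_zero.1 (norm_le_zero_iff.1 h2)).symm
  have hz : LeftInvOn (Function.invFunOn w V) w V := hinj.leftInvOn_invFunOn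
  have hderiv := fun x (hx : x ∈ V) =>
    hasDerivAt_leftInvOn_of_mul_norm_sub_le hV hwV (by positivity) hexp hd hz hx
  have hmaps : MapsTo (Function.invFunOn w V) (w '' V) V := by
    rintro _ ⟨x, hx, rfl⟩
    rwa [hz hx]
  have hexp0 : ∀ x ∈ V, ‖c‖ / 2 * ‖x‖ ≤ ‖w x‖ := fun x hx => by
    have hne : (𝓝[V] (0 : ℂ)).NeBot := by
      rw [← mem_closure_iff_nhdsWithin_neBot, hKδ]
      exact zero_mem_closure_circularSector hδ (sub_pos.1 hτ)
    have hid : Tendsto (fun y : ℂ => y) (𝓝[V] 0) (𝓝 0) :=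
      tendsto_nhdsWithin_of_tendsto_nhds tendsto_id
    have h1 := ((tendsto_const_nhds (x := x)).sub hid).norm.const_mul (‖c‖ / 2)
    have h2 := ((tendsto_const_nhds (x := w x)).sub
      (hw0.mono_left (nhdsWithin_mono 0 hVK))).norm
    rw [sub_zero] at h1 h2
    exact le_of_tendsto_of_tendsto h1 h2
      (eventually_nhdsWithin_of_forall fun y hy => hexp y hy x hx)
  have hz0 : Tendsto (Function.invFunOn w V) (𝓝[w '' V] 0) (𝓝 0) := by
    have hlim : Tendsto (fun y : ℂ => 2 / ‖c‖ * ‖y‖) (𝓝[w '' V] 0) (𝓝 0) := by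
      have : Continuous fun y : ℂ => 2 / ‖c‖ * ‖y‖ := by fun_prop
      simpa using (this.tendsto 0).mono_left nhdsWithin_le_nhds
    refine squeeze_zero_norm' (eventually_nhdsWithin_of_forall ?_) hlim
    rintro _ ⟨x, hx, rfl⟩
    rw [hz hx, div_mul_eq_mul_div, le_div_iff₀ hc']
    linarith [hexp0 x hx]
  refine ⟨hinj, Function.invFunOn w V, ?_, hmaps, hz, hz0, ?_⟩
  · rintro _ ⟨x, hx, rfl⟩
    refine DifferentiableOn.analyticAt (s := w '' V) ?_ (hderiv x hx).1
    rintro _ ⟨y, hy, rfl⟩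
    exact (hderiv y hy).2.differentiableAt.differentiableWithinAt
  · have hzK : Tendsto (Function.invFunOn w V) (𝓝[w '' V] 0) (𝓝[K] 0) :=
      tendsto_nhdsWithin_iff.2 ⟨hz0, eventually_nhdsWithin_of_forall fun y hy => hVK (hmaps hy)⟩
    refine ((hw'.comp hzK).inv₀ hc).congr' (eventually_nhdsWithin_of_forall ?_)
    rintro _ ⟨x, hx, rfl⟩
    rw [(hderiv x hx).2.deriv, Function.comp_apply, hz hx]
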